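/- Let C be an N×q complex matrix and let P be an N×N orthogonal projection (P^H = P, P^2 = P) of rank r with r ≤ q. Then Tr[(I_q + C^H P C)^{-1}] ≥ (q − r) + Σ_{k=1}^{r} 1/(1 + λ_k(C^H C)). -/

import Mathlib

open Matrix

/-- The `k`-th largest eigenvalue (0-indexed: `k = 0` is the largest) of a
Hermitian matrix. -/
noncomputable def eigDesc {n : ℕ} {A : Matrix (Fin n) (Fin n) ℂ}
    (hA : A.IsHermitian) (k : Fin n) : ℝ :=
  (hA.eigenvalues ∘ Tuple.sort hA.eigenvalues) k.rev

lemma spec_form {n : ℕ} {A : Matrix (Fin n) (Fin n) ℂ} (hA : A.IsHermitian) :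
    ∃ U : Matrix (Fin n) (Fin n) ℂ, Uᴴ * U = 1 ∧ U * Uᴴ = 1 ∧
      A = U * diagonal (fun i => ((hA.eigenvalues i : ℝ) : ℂ)) * Uᴴ := by
  refine ⟨hA.eigenvectorUnitary, ?_, ?_, ?_⟩
  · exact Unitary.coe_star_mul_self _
  · exact Unitary.coe_mul_star_self _
  · have := hA.spectral_theorem
    rw [Unitary.conjStarAlgAut_apply] at this
    exact this

lemma quad_form {n : ℕ} (U : Matrix (Fin n) (Fin n) ℂ) (d : Fin n → ℝ) (x : Fin n → ℂ) :
    (star x ⬝ᵥ ((U * diagonal (fun i => ((d i : ℝ) : ℂ)) * Uᴴ) *ᵥ x)).re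
      = ∑ i, d i * Complex.normSq ((Uᴴ *ᵥ x) i) := by
  have h : star x ⬝ᵥ ((U * diagonal (fun i => ((d i : ℝ) : ℂ)) * Uᴴ) *ᵥ x)
      = star (Uᴴ *ᵥ x) ⬝ᵥ (diagonal (fun i => ((d i : ℝ) : ℂ)) *ᵥ (Uᴴ *ᵥ x)) := by
    rw [star_mulVec, conjTranspose_conjTranspose, ← dotProduct_mulVec, mulVec_mulVec, mulVec_mulVec,
      Matrix.mul_assoc]
  rw [h]
  simp only [dotProduct, mulVec_diagonal, Complex.re_sum, Pi.star_apply]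
  refine Finset.sum_congr rfl fun i _ => ?_
  simp [Complex.normSq_apply]
  ring

lemma norm_form {n : ℕ} (U : Matrix (Fin n) (Fin n) ℂ) (hU : U * Uᴴ = 1) (x : Fin n → ℂ) :
    ∑ i, Complex.normSq ((Uᴴ *ᵥ x) i) = ∑ i, Complex.normSq (x i) := by
  have h1 := quad_form U (fun _ => 1) x
  have h2 := quad_form (1 : Matrix (Fin n) (Fin n) ℂ) (fun _ => 1) x
  simp [hU] at h1 h2
  rw [← h1, ← h2]

lemma eigDesc_antitone {n : ℕ} {A : Matrix (Fin n) (Fin n) ℂ} (hA : A.IsHermitian) :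
    Antitone (eigDesc hA) := fun _ _ h =>
  Tuple.monotone_sort hA.eigenvalues (Fin.rev_le_rev.2 h)

/-- the permutation sorting eigenvalues decreasingly -/
noncomputable def sigD {n : ℕ} {A : Matrix (Fin n) (Fin n) ℂ} (hA : A.IsHermitian) :
    Equiv.Perm (Fin n) := Fin.revPerm.trans (Tuple.sort hA.eigenvalues)

lemma eigDesc_eq {n : ℕ} {A : Matrix (Fin n) (Fin n) ℂ} (hA : A.IsHermitian) (k : Fin n) :
    eigDesc hA k = hA.eigenvalues (sigD hA k) := rfl

lemma weyl {n : ℕ} {A B : Matrix (Fin n) (Fin n) ℂ} (hA : A.IsHermitian) (hB : B.IsHermitian)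
    (hle : ∀ x : Fin n → ℂ, (star x ⬝ᵥ (B *ᵥ x)).re ≤ (star x ⬝ᵥ (A *ᵥ x)).re) (k : Fin n) :
    eigDesc hB k ≤ eigDesc hA k := by
  obtain ⟨U, hU1, hU2, hUA⟩ := spec_form hA
  obtain ⟨V, hV1, hV2, hVB⟩ := spec_form hB
  let f : (Fin n → ℂ) →ₗ[ℂ] ({j : Fin n // j ≠ k} → ℂ) := LinearMap.pi fun j =>
    if k < j.1 then (LinearMap.proj (sigD hB j.1)) ∘ₗ Matrix.mulVecLin Vᴴ
    else (LinearMap.proj (sigD hA j.1)) ∘ₗ Matrix.mulVecLin Uᴴ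
  have hk : LinearMap.ker f ≠ ⊥ := by
    apply LinearMap.ker_ne_bot_of_finrank_lt
    simp
    exact k.pos
  obtain ⟨x, hx, hx0⟩ := Submodule.exists_mem_ne_zero_of_ne_bot hk
  have hfx : ∀ j : {j : Fin n // j ≠ k}, f x j = 0 := fun j => by
    rw [LinearMap.mem_ker.1 hx]; rfl
  have hVz : ∀ j, k < j → (Vᴴ *ᵥ x) (sigD hB j) = 0 := fun j hj => by
    have := hfx ⟨j, hj.ne'⟩
    simpa [f, hj] using this
  have hUz : ∀ j, j < k → (Uᴴ *ᵥ x) (sigD hA j) = 0 := fun j hj => by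
    have := hfx ⟨j, hj.ne⟩
    simpa [f, hj.not_gt] using this
  have hpos : 0 < ∑ i, Complex.normSq (x i) := by
    obtain ⟨i, hi⟩ := Function.ne_iff.1 hx0
    exact Finset.sum_pos' (fun i _ => Complex.normSq_nonneg _)
      ⟨i, Finset.mem_univ _, Complex.normSq_pos.2 hi⟩
  have h := hle x
  have eA := quad_form U hA.eigenvalues x
  have eB := quad_form V hB.eigenvalues x
  rw [← hUA] at eA
  rw [← hVB] at eB
  rw [eA, eB] at h
  have h1 : eigDesc hB k * ∑ i, Complex.normSq (x i)
      ≤ ∑ i, hB.eigenvalues i * Complex.normSq ((Vᴴ *ᵥ x) i) := by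
    rw [← norm_form V hV2 x, Finset.mul_sum, ← Equiv.sum_comp (sigD hB),
      ← Equiv.sum_comp (sigD hB) (fun i => hB.eigenvalues i * _)]
    refine Finset.sum_le_sum fun j _ => ?_
    rcases lt_or_ge k j with hj | hj
    · simp [hVz j hj]
    · exact mul_le_mul_of_nonneg_right (eigDesc_antitone hB hj) (Complex.normSq_nonneg _)
  have h2 : ∑ i, hA.eigenvalues i * Complex.normSq ((Uᴴ *ᵥ x) i)
      ≤ eigDesc hA k * ∑ i, Complex.normSq (x i) := by
    rw [← norm_form U hU2 x, Finset.mul_sum, ← Equiv.sum_comp (sigD hA),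
      ← Equiv.sum_comp (sigD hA) (fun i => eigDesc hA k * _)]
    refine Finset.sum_le_sum fun j _ => ?_
    rcases lt_or_ge j k with hj | hj
    · simp [hUz j hj]
    · exact mul_le_mul_of_nonneg_right (eigDesc_antitone hA hj) (Complex.normSq_nonneg _)
  exact le_of_mul_le_mul_right (h1.trans (h.trans h2)) hpos

lemma trace_inv {n : ℕ} {B : Matrix (Fin n) (Fin n) ℂ} (hB : B.IsHermitian)
    (hn : ∀ i, 0 ≤ hB.eigenvalues i) :
    (trace ((1 + B)⁻¹)).re = ∑ k, 1 / (1 + eigDesc hB k) := by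
  obtain ⟨V, hV1, hV2, hVB⟩ := spec_form hB
  set d := hB.eigenvalues with hd
  have hne : ∀ i, (1 + (d i : ℂ)) ≠ 0 := fun i => by
    have := hn i
    have : (1 + d i) ≠ 0 := by positivity
    exact_mod_cast this
  have e : (1 + B)⁻¹ = V * diagonal (fun i => (((1 / (1 + d i) : ℝ)) : ℂ)) * Vᴴ := by
    apply inv_eq_right_inv
    have : 1 + B = V * diagonal (fun i => 1 + (d i : ℂ)) * Vᴴ := by
      rw [← diagonal_add, diagonal_one, Matrix.mul_add, Matrix.add_mul, ← hVB, Matrix.mul_one, hV2]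
    rw [this]
    calc _ = V * (diagonal (fun i => 1 + (d i : ℂ)) * (Vᴴ * V) *
          diagonal (fun i => (((1 / (1 + d i) : ℝ)) : ℂ))) * Vᴴ := by
            simp only [Matrix.mul_assoc]
      _ = 1 := by
        rw [hV1, Matrix.mul_one, diagonal_mul_diagonal]
        have : (fun i => (1 + (d i : ℂ)) * (((1 / (1 + d i) : ℝ)) : ℂ)) = fun _ => 1 := by
          funext i
          push_cast
          field_simp [hne i]
        rw [this, diagonal_one, Matrix.mul_one, hV2]
  rw [e, trace_mul_comm, ← Matrix.mul_assoc, hV1, Matrix.one_mul, trace_diagonal, Complex.re_sum,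
    ← Equiv.sum_comp (sigD hB)]
  exact Finset.sum_congr rfl fun i _ => Complex.ofReal_re _

lemma eig_zero {n : ℕ} {B : Matrix (Fin n) (Fin n) ℂ} (hB : B.IsHermitian)
    (hn : ∀ i, 0 ≤ hB.eigenvalues i) (r : ℕ) (hr : B.rank ≤ r) (k : Fin n) (hk : r ≤ k) :
    eigDesc hB k = 0 := by
  by_contra h0
  have hp : 0 < eigDesc hB k := lt_of_le_of_ne (hn _) (Ne.symm h0)
  rw [hB.rank_eq_card_non_zero_eigs] at hr
  have : Fintype.card (Fin (k+1)) ≤ Fintype.card {i // hB.eigenvalues i ≠ 0} := by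
    refine Fintype.card_le_of_injective
      (fun j => ⟨sigD hB ⟨j, by omega⟩, ?_⟩) ?_
    · have : eigDesc hB k ≤ eigDesc hB ⟨j, by omega⟩ :=
        eigDesc_antitone hB (Fin.mk_le_of_le_val (by have := j.2; omega))
      exact (hp.trans_le this).ne'
    · intro a b hab
      have h1 := (sigD hB).injective (Subtype.ext_iff.1 hab)
      rw [Fin.mk.injEq] at h1
      exact Fin.ext h1
  simp only [Fintype.card_fin] at this
  omega

open scoped ComplexOrder in
lemma gram_eig {m n : ℕ} {B : Matrix (Fin n) (Fin n) ℂ} (M : Matrix (Fin m) (Fin n) ℂ)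
    (h : B = Mᴴ * M) (hB : B.IsHermitian) (i : Fin n) : 0 ≤ hB.eigenvalues i := by
  have hPS : B.PosSemidef := h ▸ posSemidef_conjTranspose_mul_self M
  exact hPS.eigenvalues_nonneg i

open scoped ComplexOrder in
lemma gram_quad {m n : ℕ} {B : Matrix (Fin n) (Fin n) ℂ} (M : Matrix (Fin m) (Fin n) ℂ)
    (h : B = Mᴴ * M) (x : Fin n → ℂ) : 0 ≤ (star x ⬝ᵥ (B *ᵥ x)).re := by
  have hPS : B.PosSemidef := h ▸ posSemidef_conjTranspose_mul_self M
  exact hPS.re_dotProduct_nonneg x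

/-- Lower bound on the noiseless-fusion-center MSE `Tr[(I_q + Cᴴ P C)⁻¹]`
for an orthogonal projection `P` of rank `r ≤ q`:
`Tr[(I_q + Cᴴ P C)⁻¹] ≥ (q − r) + Σ_{k=1}^{r} 1/(1 + λ_k(Cᴴ C))`. -/
theorem stmt2 {N q : ℕ} (C : Matrix (Fin N) (Fin q) ℂ)
    (P : Matrix (Fin N) (Fin N) ℂ) (hP1 : Pᴴ = P) (hP2 : P * P = P)
    (r : ℕ) (hr : P.rank = r) (hrq : r ≤ q)
    (hC : (Cᴴ * C).IsHermitian) :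
    ((q : ℝ) - r) + ∑ k : Fin r, 1 / (1 + eigDesc hC (Fin.castLE hrq k)) ≤
      (Matrix.trace ((1 + Cᴴ * P * C)⁻¹)).re := by
  have hBe : Cᴴ * P * C = (P * C)ᴴ * (P * C) := by
    rw [conjTranspose_mul, hP1, Matrix.mul_assoc Cᴴ P (P * C), ← Matrix.mul_assoc P P C, hP2,
      Matrix.mul_assoc]
  have hB : (Cᴴ * P * C).IsHermitian := hBe ▸ isHermitian_conjTranspose_mul_self _
  have hn : ∀ i, 0 ≤ hB.eigenvalues i := gram_eig _ hBe hB
  have hQ : (Cᴴ * C - Cᴴ * P * C) = ((1 - P) * C)ᴴ * ((1 - P) * C) := by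
    have h1 : (1 - P)ᴴ = 1 - P := by simp [hP1]
    have h2 : (1 - P) * (1 - P) = 1 - P := by
      simp [Matrix.mul_sub, Matrix.sub_mul, hP2]
    rw [conjTranspose_mul, h1, Matrix.mul_assoc Cᴴ (1 - P) ((1 - P) * C), ← Matrix.mul_assoc (1 - P) (1 - P) C, h2]
    simp [Matrix.mul_sub, Matrix.sub_mul, Matrix.mul_assoc]
  have hle := weyl hC hB (fun x => by
    have := gram_quad _ hQ x
    simp [sub_mulVec, dotProduct_sub] at this
    exact this)
  have hrank : (Cᴴ * P * C).rank ≤ r :=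
    ((rank_mul_le_left _ _).trans (rank_mul_le_right _ _)).trans hr.le
  rw [trace_inv hB hn]
  obtain ⟨s, rfl⟩ := Nat.exists_eq_add_of_le hrq
  rw [Fin.sum_univ_add, add_comm]
  refine add_le_add ?_ ?_
  · refine Finset.sum_le_sum fun k _ => ?_
    have h0 : 0 ≤ eigDesc hB (Fin.castAdd s k) := hn _
    exact one_div_le_one_div_of_le (by positivity) (add_le_add_right (hle (Fin.castAdd s k)) 1)
  · have : ∀ j : Fin s, eigDesc hB (Fin.natAdd r j) = 0 := fun j =>
      eig_zero hB hn r hrank _ (by simp)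
    simp [this]
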